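/- Let σ, σ₁ : 2^S → ℝ_{>0} be two functions and let λ be a shape of W. Then there is a unit u of Solomon's descent algebra Σ(W) such that u e^σ_λ = e^{σ₁}_λ u; consequently left multiplication by u defines an isomorphism of right ℂW-modules E^σ_λ = e^σ_λ ℂW → e^{σ₁}_λ ℂW = E^{σ₁}_λ. -/

import Mathlib

open scoped Classical
open MonoidAlgebra Finset

noncomputable section

namespace DPR

variable {B : Type} {W : Type} [Group W] [Fintype W] [DecidableEq W]
  {M : CoxeterMatrix B}

/-- The set `S` of simple reflections of the Coxeter system, as a finset of `W`. -/
def Simples (cs : CoxeterSystem M W) : Finset W :=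
  Finset.univ.filter (fun w => ∃ i, cs.simple i = w)

/-- The set `W^I` of minimal length left coset representatives of `W_I`,
computed inside the subset `H` of `W` (take `H = Set.univ` for the absolute case). -/
def minCoset (cs : CoxeterSystem M W) (H : Set W) (I : Finset W) : Finset W :=
  Finset.univ.filter (fun w => w ∈ H ∧ ∀ s ∈ I, cs.length w < cs.length (w * s))

/-- The element `x_I = ∑_{w ∈ W^I} w` of the group algebra `ℂ W`, relative to `H`. -/
def xRel (cs : CoxeterSystem M W) (H : Set W) (I : Finset W) : MonoidAlgebra ℂ W :=
  ∑ w ∈ minCoset cs H I, of ℂ W w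

/-- `w(Δ_J) ⊆ Δ_D`:  for every `s ∈ J`, `wsw⁻¹ ∈ D` and `ℓ(ws) = ℓ(w) + 1`. -/
def Takes (cs : CoxeterSystem M W) (D : Finset W) (w : W) (J : Finset W) : Prop :=
  ∀ s ∈ J, w * s * w⁻¹ ∈ D ∧ cs.length (w * s) = cs.length w + 1

/-- `ᵂJ = wJw⁻¹`. -/
def conjF (w : W) (J : Finset W) : Finset W := J.image (fun s => w * s * w⁻¹)

/-- The coefficient `m^σ_{JK}`, computed relative to the pair `(H, D)`
(`H = Set.univ`, `D = S` in the absolute case). -/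
def mC (cs : CoxeterSystem M W) (H : Set W) (D : Finset W) (σ : Finset W → ℝ)
    (J K : Finset W) : ℝ :=
  if J ⊆ K then
    ∑ w ∈ (minCoset cs H K).filter (fun w => Takes cs D w J), σ (conjF w J)
  else 0

/-- The family `(e_J)` is a family of BBHT quasi-idempotents, relative to `(H, D, σ)`:
it solves the defining triangular system `x_K = ∑_{J ⊆ K} m^σ_{JK} e_J` for all `K ⊆ D`. -/
def IsBBHT (cs : CoxeterSystem M W) (H : Set W) (D : Finset W) (σ : Finset W → ℝ)
    (e : Finset W → MonoidAlgebra ℂ W) : Prop :=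
  ∀ K ∈ D.powerset, xRel cs H K = ∑ J ∈ K.powerset, (mC cs H D σ J K : ℂ) • e J

/-- `σ` takes positive values (on subsets of `D`). -/
def PosOn (D : Finset W) (σ : Finset W → ℝ) : Prop := ∀ I ∈ D.powerset, 0 < σ I

/-- Two subsets of `S` have the same shape if the parabolic subgroups they generate
are conjugate in `W`. -/
def ShapeEq (I J : Finset W) : Prop :=
  ∃ w : W, Subgroup.closure (J : Set W) =
    Subgroup.map (MulAut.conj w).toMonoidHom (Subgroup.closure (I : Set W))

/-- Solomon's descent algebra, as a subspace of the group algebra: the span of the `x_I`. -/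
def descAlg (cs : CoxeterSystem M W) : Submodule ℂ (MonoidAlgebra ℂ W) :=
  Submodule.span ℂ {a | ∃ I ∈ (Simples cs).powerset, a = xRel cs Set.univ I}

/-! ### The exchange condition -/

section Exchange

variable {B W : Type} [Group W] {M : CoxeterMatrix B} (cs : CoxeterSystem M W)

lemma end_mul_apply {α : Type} (f g : Function.End α) (x : α) : (f * g) x = f (g x) := rfl

lemma end_one_apply {α : Type} (x : α) : (1 : Function.End α) x = x := rfl

/-- The action of a simple reflection on pairs `(t, ε)`: conjugate `t`, and flip the sign `ε`
if `t` is the given simple reflection. -/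
def signedConj (i : B) : Function.End (W × ZMod 2) := fun p =>
  (cs.simple i * p.1 * cs.simple i, p.2 + if p.1 = cs.simple i then 1 else 0)

lemma signedConj_mul_pow (i j : B) (k : ℕ) (t : W) (ε : ZMod 2) :
    ((signedConj cs i * signedConj cs j) ^ k) (t, ε) =
      ((cs.simple i * cs.simple j) ^ k * t * ((cs.simple i * cs.simple j) ^ k)⁻¹,
        ε + ∑ n ∈ Finset.range (2 * k),
          if t = cs.simple j * (cs.simple i * cs.simple j) ^ n then 1 else 0) := by
  induction k with
  | zero => simp [end_one_apply]
  | succ k ih =>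
    set a := cs.simple i with ha
    set b := cs.simple j with hb
    have haa : a * a = 1 := cs.simple_mul_simple_self i
    have hbb : b * b = 1 := cs.simple_mul_simple_self j
    have hai : a⁻¹ = a := cs.inv_simple i
    have hbi : b⁻¹ = b := cs.inv_simple j
    set p := a * b with hp
    have hpb : ∀ n : ℕ, (p ^ n)⁻¹ * b = b * p ^ n := by
      intro n
      induction n with
      | zero => simp
      | succ n ihn =>
        have hpi : p⁻¹ * b = b * p := by rw [hp, mul_inv_rev, hai, hbi, mul_assoc]
        rw [pow_succ', mul_inv_rev, mul_assoc, hpi, ← mul_assoc, ihn, mul_assoc,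
          pow_mul_comm']
    have h1 : (p ^ k * t * (p ^ k)⁻¹ = b) ↔ t = b * p ^ (2 * k) := by
      rw [mul_inv_eq_iff_eq_mul, ← eq_inv_mul_iff_mul_eq, ← mul_assoc, hpb, mul_assoc,
        ← pow_add, two_mul]
    have h2 : (b * (p ^ k * t * (p ^ k)⁻¹) * b = a) ↔ t = b * p ^ (2 * k + 1) := by
      have : (b * (p ^ k * t * (p ^ k)⁻¹) * b = a) ↔ p ^ k * t * (p ^ k)⁻¹ = b * a * b := by
        constructor
        · intro h
          rw [← h]
          simp only [mul_assoc, hbb, mul_one]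
          simp only [← mul_assoc, hbb, one_mul]
        · intro h
          rw [h]
          simp only [mul_assoc, hbb, mul_one]
          simp only [← mul_assoc, hbb, one_mul]
      rw [this, mul_inv_eq_iff_eq_mul, ← eq_inv_mul_iff_mul_eq]
      have e : (p ^ k)⁻¹ * (b * a * b * p ^ k) = b * p ^ (2 * k + 1) := by
        rw [mul_assoc b a b, ← hp, mul_assoc b, ← mul_assoc, hpb, mul_assoc, ← pow_succ',
          ← pow_add]
        congr 2
        omega
      rw [e]
    rw [pow_succ', end_mul_apply, ih, end_mul_apply]
    simp only [signedConj, ← ha, ← hb, h1, h2]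
    refine Prod.ext ?_ ?_
    · simp only [pow_succ', hp, mul_inv_rev, hai, hbi, mul_assoc]
    · simp only
      rw [show 2 * (k + 1) = 2 * k + 1 + 1 by ring, Finset.sum_range_succ, Finset.sum_range_succ]
      ring

lemma isLiftable_signedConj : M.IsLiftable (signedConj cs) := by
  intro i j
  funext ⟨t, ε⟩
  rw [signedConj_mul_pow, two_mul, Finset.sum_range_add]
  simp only [pow_add, cs.simple_mul_simple_pow, one_mul]
  rw [CharTwo.add_self_eq_zero]
  simp [end_one_apply]

/-- The action of the whole Coxeter group on signed group elements. -/
def signedConjHom : W →* Function.End (W × ZMod 2) :=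
  cs.lift ⟨signedConj cs, isLiftable_signedConj cs⟩

lemma signedConjHom_wordProd (ω : List B) (t : W) (ε : ZMod 2) :
    signedConjHom cs (cs.wordProd ω) (t, ε) =
      (cs.wordProd ω * t * (cs.wordProd ω)⁻¹, ε + ((cs.rightInvSeq ω).count t : ZMod 2)) := by
  induction ω with
  | nil => simp [end_one_apply]
  | cons i ω ih =>
    have hs : signedConjHom cs (cs.simple i) = signedConj cs i := cs.lift_apply_simple _ i
    rw [cs.wordProd_cons, map_mul, end_mul_apply, ih, hs]
    refine Prod.ext ?_ ?_
    · simp [signedConj, mul_assoc]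
    · have h : (cs.wordProd ω * t * (cs.wordProd ω)⁻¹ = cs.simple i) ↔
          ((cs.wordProd ω)⁻¹ * cs.simple i * cs.wordProd ω = t) := by
        rw [mul_inv_eq_iff_eq_mul, ← eq_inv_mul_iff_mul_eq, ← mul_assoc, eq_comm]
      simp only [signedConj, h, CoxeterSystem.rightInvSeq, List.count_cons, beq_iff_eq]
      push_cast
      ring

/-- The exchange condition, for words that need not be reduced. -/
lemma exists_eraseIdx_of_length_lt (ω : List B) (i : B)
    (h : cs.length (cs.wordProd ω * cs.simple i) < cs.length (cs.wordProd ω)) :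
    ∃ k < ω.length, cs.wordProd ω * cs.simple i = cs.wordProd (ω.eraseIdx k) := by
  obtain ⟨ω', hω', hw⟩ := cs.exists_isReduced (cs.wordProd ω * cs.simple i)
  have hw' : cs.wordProd ω = cs.wordProd (ω'.concat i) := by
    rw [cs.wordProd_concat, ← hw]
    simp
  have hnot : cs.simple i ∉ cs.rightInvSeq ω' := by
    intro hm
    have := (cs.isRightInversion_of_mem_rightInvSeq hω' hm).2
    rw [← hw, cs.simple_mul_simple_cancel_right] at this
    omega
  have hcount : (cs.rightInvSeq (ω'.concat i)).count (cs.simple i) = 1 := by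
    have h0 : cs.simple i ∉ (cs.rightInvSeq ω').map (MulAut.conj (cs.simple i)) := by
      intro hm
      obtain ⟨r, hr, hri⟩ := List.mem_map.1 hm
      have : r = cs.simple i := by
        rw [MulAut.conj_apply, mul_inv_eq_iff_eq_mul] at hri
        exact mul_left_cancel hri
      exact hnot (this ▸ hr)
    rw [cs.rightInvSeq_concat, List.concat_eq_append, List.count_append,
      List.count_eq_zero_of_not_mem h0]
    simp
  have key : ((cs.rightInvSeq ω).count (cs.simple i) : ZMod 2) = 1 := by
    have h1 := signedConjHom_wordProd cs ω (cs.simple i) 0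
    have h2 := signedConjHom_wordProd cs (ω'.concat i) (cs.simple i) 0
    rw [← hw', h1] at h2
    have := congrArg Prod.snd h2
    simpa only [hcount, zero_add, Nat.cast_one] using this
  have hmem : cs.simple i ∈ cs.rightInvSeq ω := by
    by_contra hn
    rw [List.count_eq_zero_of_not_mem hn] at key
    simp at key
  obtain ⟨k, hk, hki⟩ := List.mem_iff_getElem.1 hmem
  refine ⟨k, by simpa using hk, ?_⟩
  rw [← cs.wordProd_mul_getD_rightInvSeq, List.getD_eq_getElem _ _ hk, hki]

/-- The exchange condition for a product `u * v`: a right descent of `u * v` comes either from `v`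
or, after conjugation by `v`, from `u`. -/
lemma length_mul_simple_lt_or (u v : W) (i : B)
    (h : cs.length (u * v * cs.simple i) < cs.length (u * v)) :
    cs.length (v * cs.simple i) < cs.length v ∨
      cs.length (u * (v * cs.simple i * v⁻¹)) < cs.length u := by
  obtain ⟨α, hα, rfl⟩ := cs.exists_isReduced u
  obtain ⟨β, hβ, rfl⟩ := cs.exists_isReduced v
  rw [← cs.wordProd_append] at h
  obtain ⟨k, hk, hk'⟩ := exists_eraseIdx_of_length_lt cs _ i h
  rw [cs.wordProd_append] at hk'
  rw [hα.eq, hβ.eq]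
  rcases lt_or_ge k α.length with hlt | hge
  · right
    rw [List.eraseIdx_append_of_lt_length hlt, cs.wordProd_append] at hk'
    have : cs.wordProd α * (cs.wordProd β * cs.simple i * (cs.wordProd β)⁻¹) =
        cs.wordProd (α.eraseIdx k) := by
      rw [← mul_assoc, ← mul_assoc, hk', mul_inv_cancel_right]
    rw [this]
    have h1 := cs.length_wordProd_le (α.eraseIdx k)
    have h2 := List.length_eraseIdx_add_one hlt
    omega
  · left
    rw [List.eraseIdx_append_of_length_le hge, cs.wordProd_append, mul_assoc] at hk'
    rw [mul_left_cancel hk']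
    have h1 := cs.length_wordProd_le (β.eraseIdx (k - α.length))
    have h2 := List.length_eraseIdx_add_one (l := β) (i := k - α.length)
      (by rw [List.length_append] at hk; omega)
    omega

end Exchange

/-! ### Minimal coset representatives of standard parabolic subgroups -/

omit [DecidableEq W] in
lemma mem_simples {cs : CoxeterSystem M W} {s : W} : s ∈ Simples cs ↔ ∃ i, cs.simple i = s := by
  simp [Simples]

lemma mem_minCoset {cs : CoxeterSystem M W} {I : Finset W} {w : W} :
    w ∈ minCoset cs Set.univ I ↔ ∀ s ∈ I, cs.length w < cs.length (w * s) := by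
  simp [minCoset]

omit [DecidableEq W] in
/-- Every element of a standard parabolic subgroup has a reduced word in its generators. -/
lemma exists_isReduced_of_mem_closure (cs : CoxeterSystem M W) {I : Finset W}
    (hI : I ⊆ Simples cs) {a : W} (ha : a ∈ Subgroup.closure (I : Set W)) :
    ∃ ω : List B, (∀ i ∈ ω, cs.simple i ∈ I) ∧ cs.IsReduced ω ∧ cs.wordProd ω = a := by
  have step : ∀ (x s : W), s ∈ I →
      (∃ ω : List B, (∀ i ∈ ω, cs.simple i ∈ I) ∧ cs.IsReduced ω ∧ cs.wordProd ω = x) →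
      ∃ ω : List B, (∀ i ∈ ω, cs.simple i ∈ I) ∧ cs.IsReduced ω ∧ cs.wordProd ω = x * s := by
    rintro x s hs ⟨ω, hω, hr, rfl⟩
    obtain ⟨i, rfl⟩ := mem_simples.1 (hI hs)
    rcases cs.length_mul_simple (cs.wordProd ω) i with h | h
    · refine ⟨ω.concat i, ?_, ?_, cs.wordProd_concat i ω⟩
      · intro j hj
        rcases List.mem_append.1 (List.concat_eq_append ▸ hj) with hj | hj
        · exact hω j hj
        · rwa [List.mem_singleton.1 hj]
      · rw [CoxeterSystem.IsReduced, cs.wordProd_concat, h, hr.eq, List.length_concat]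
    · obtain ⟨k, hk, hk'⟩ := exists_eraseIdx_of_length_lt cs ω i (by omega)
      refine ⟨ω.eraseIdx k, fun j hj => hω j (List.mem_of_mem_eraseIdx hj), ?_, hk'.symm⟩
      have := List.length_eraseIdx_add_one hk
      rw [hr.eq, hk'] at h
      rw [CoxeterSystem.IsReduced]
      omega
  induction ha using Subgroup.closure_induction_right with
  | one => exact ⟨[], by simp, by simp [CoxeterSystem.IsReduced], by simp⟩
  | mul_right x hx s hs ih => exact step x s hs ih
  | mul_inv_cancel x hx s hs ih =>
    obtain ⟨i, rfl⟩ := mem_simples.1 (hI hs)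
    rw [cs.inv_simple]
    exact step x _ hs ih

omit [Fintype W] [DecidableEq W] in
lemma length_mul_wordProd_of_minimal (cs : CoxeterSystem M W) {I : Finset W} {y : W}
    (hy : ∀ c ∈ Subgroup.closure (I : Set W), cs.length y ≤ cs.length (y * c)) (ω : List B)
    (hω : ∀ i ∈ ω, cs.simple i ∈ I) (hr : cs.IsReduced ω) :
    cs.length (y * cs.wordProd ω) = cs.length y + ω.length := by
  induction ω using List.reverseRecOn with
  | nil => simp
  | append_singleton ω i ih =>
    have hr' : cs.IsReduced ω := by simpa using hr.take ω.length
    have ih' := ih (fun j hj => hω j (by simp [hj])) hr'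
    have hmem : ∀ ω' : List B, (∀ j ∈ ω', cs.simple j ∈ I) →
        cs.wordProd ω' ∈ Subgroup.closure (I : Set W) := by
      intro ω' h
      induction ω' with
      | nil => simp
      | cons j ω' ihω =>
        rw [cs.wordProd_cons]
        exact mul_mem (Subgroup.subset_closure (h j (by simp)))
          (ihω fun l hl => h l (by simp [hl]))
    have hr2 := hr.eq
    rw [cs.wordProd_append, cs.wordProd_singleton, List.length_append, List.length_singleton] at hr2
    rw [cs.wordProd_append, cs.wordProd_singleton, ← mul_assoc, List.length_append,
      List.length_singleton]
    rcases cs.length_mul_simple (y * cs.wordProd ω) i with h | h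
    · omega
    · exfalso
      rcases length_mul_simple_lt_or cs y (cs.wordProd ω) i (by omega) with h' | h'
      · rw [hr2, hr'.eq] at h'
        omega
      · have h1 := hmem ω fun j hj => hω j (by simp [hj])
        have := hy _ (mul_mem (mul_mem h1 (Subgroup.subset_closure (hω i (by simp))))
          (inv_mem h1))
        omega

omit [DecidableEq W] in
lemma exists_minimal_mul (cs : CoxeterSystem M W) (I : Finset W) (w : W) :
    ∃ c₀ ∈ Subgroup.closure (I : Set W), ∀ c ∈ Subgroup.closure (I : Set W),
      cs.length (w * c₀) ≤ cs.length (w * c₀ * c) := by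
  obtain ⟨c₀, hc₀, hmin⟩ := Set.exists_min_image (Subgroup.closure (I : Set W) : Set W)
    (fun c => cs.length (w * c)) (Set.toFinite _) ⟨1, one_mem _⟩
  refine ⟨c₀, hc₀, fun c hc => ?_⟩
  rw [mul_assoc]
  exact hmin _ (mul_mem hc₀ hc)

lemma le_length_mul_of_mem_minCoset (cs : CoxeterSystem M W) {I : Finset W}
    (hI : I ⊆ Simples cs) {y c : W} (hy : y ∈ minCoset cs Set.univ I)
    (hc : c ∈ Subgroup.closure (I : Set W)) : cs.length y ≤ cs.length (y * c) := by
  obtain ⟨c₀, hc₀, hmin⟩ := exists_minimal_mul cs I y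
  obtain ⟨ω, hω, hr, hp⟩ := exists_isReduced_of_mem_closure cs hI (inv_mem hc₀)
  have hadd := length_mul_wordProd_of_minimal cs hmin
  rcases List.eq_nil_or_concat ω with rfl | ⟨ω', i, rfl⟩
  · have : c₀ = 1 := by simpa using hp.symm
    simpa [this] using hmin c hc
  · exfalso
    rw [List.concat_eq_append] at *
    have h1 := hadd _ hω hr
    have h2 := hadd ω' (fun j hj => hω j (by simp [hj])) (by simpa using hr.take ω'.length)
    have h3 := mem_minCoset.1 hy _ (hω i (by simp))
    rw [hp, mul_inv_cancel_right, List.length_append, List.length_singleton] at h1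
    rw [cs.wordProd_append, cs.wordProd_singleton] at hp
    have h4 : y * c₀ * cs.wordProd ω' = y * cs.simple i := by
      rw [mul_assoc]
      congr 1
      rw [← inv_inj, mul_inv_rev, ← hp, cs.inv_simple]
      group
    rw [h4] at h2
    omega

/-- Lengths add up in the parabolic decomposition `W = W^I W_I`. -/
lemma length_mul_of_mem_minCoset (cs : CoxeterSystem M W) {I : Finset W} (hI : I ⊆ Simples cs)
    {y a : W} (hy : y ∈ minCoset cs Set.univ I) (ha : a ∈ Subgroup.closure (I : Set W)) :
    cs.length (y * a) = cs.length y + cs.length a := by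
  obtain ⟨ω, hω, hr, rfl⟩ := exists_isReduced_of_mem_closure cs hI ha
  rw [length_mul_wordProd_of_minimal cs
    (fun c hc => le_length_mul_of_mem_minCoset cs hI hy hc) ω hω hr, hr.eq]

lemma exists_mul_of_minCoset (cs : CoxeterSystem M W) {I : Finset W} (hI : I ⊆ Simples cs)
    (w : W) : ∃ y ∈ minCoset cs Set.univ I, ∃ a ∈ Subgroup.closure (I : Set W), y * a = w := by
  obtain ⟨c₀, hc₀, hmin⟩ := exists_minimal_mul cs I w
  refine ⟨w * c₀, mem_minCoset.2 fun s hs => ?_, c₀⁻¹, inv_mem hc₀, by simp⟩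
  obtain ⟨i, rfl⟩ := mem_simples.1 (hI hs)
  exact lt_of_le_of_ne (hmin _ (Subgroup.subset_closure hs)) (cs.length_mul_simple_ne _ i).symm

lemma eq_of_mem_minCoset (cs : CoxeterSystem M W) {I : Finset W} (hI : I ⊆ Simples cs)
    {y y' : W} (hy : y ∈ minCoset cs Set.univ I) (hy' : y' ∈ minCoset cs Set.univ I)
    (h : y⁻¹ * y' ∈ Subgroup.closure (I : Set W)) : y = y' := by
  have h1 := length_mul_of_mem_minCoset cs hI hy h
  have h2 := length_mul_of_mem_minCoset cs hI hy' (inv_mem h)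
  have e : y' * (y⁻¹ * y')⁻¹ = y := by group
  rw [mul_inv_cancel_left] at h1
  rw [e, cs.length_inv] at h2
  have : y⁻¹ * y' = 1 := cs.length_eq_zero_iff.1 (by omega)
  exact (inv_mul_eq_one.1 this)

omit [DecidableEq W] in
lemma mem_of_mem_closure_of_length_eq_one (cs : CoxeterSystem M W) {I : Finset W}
    (hI : I ⊆ Simples cs) {t : W} (ht : t ∈ Subgroup.closure (I : Set W))
    (hl : cs.length t = 1) : t ∈ I := by
  obtain ⟨ω, hω, hr, rfl⟩ := exists_isReduced_of_mem_closure cs hI ht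
  rw [hr.eq] at hl
  obtain ⟨i, rfl⟩ := List.length_eq_one_iff.1 hl
  simpa using hω i (by simp)

/-- If `y ∈ W^I` and `s` is an ascent of `b` with `bsb⁻¹ ∈ W_I`, then `s` is an ascent of `yb`. -/
lemma length_lt_mul_mul (cs : CoxeterSystem M W) {I : Finset W} (hI : I ⊆ Simples cs)
    {y b s : W} (hy : y ∈ minCoset cs Set.univ I) (hs : s ∈ Simples cs)
    (ht : b * s * b⁻¹ ∈ Subgroup.closure (I : Set W)) (hb : cs.length b < cs.length (b * s)) :
    cs.length (y * b) < cs.length (y * b * s) := by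
  obtain ⟨i, rfl⟩ := mem_simples.1 hs
  by_contra hn
  rcases length_mul_simple_lt_or cs y b i
    (lt_of_le_of_ne (not_lt.1 hn) (cs.length_mul_simple_ne _ i)) with h | h
  · omega
  · have := le_length_mul_of_mem_minCoset cs hI hy ht
    omega

lemma length_lt_of_mul_mul (cs : CoxeterSystem M W) {I : Finset W} (hI : I ⊆ Simples cs)
    {y b s : W} (hy : y ∈ minCoset cs Set.univ I) (hs : s ∈ Simples cs)
    (ht : b * s * b⁻¹ ∈ Subgroup.closure (I : Set W))
    (hyb : cs.length (y * b) < cs.length (y * b * s)) :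
    cs.length b < cs.length (b * s) := by
  by_contra hn
  have hss : s * s = 1 := by
    obtain ⟨i, rfl⟩ := mem_simples.1 hs
    exact cs.simple_mul_simple_self i
  have hne : cs.length (b * s) ≠ cs.length b := by
    obtain ⟨i, rfl⟩ := mem_simples.1 hs
    exact cs.length_mul_simple_ne b i
  have h := length_lt_mul_mul cs hI (b := b * s) hy hs (by
    have : b * s * s * (b * s)⁻¹ = b * s * b⁻¹ := by
      rw [mul_inv_rev, inv_eq_of_mul_eq_one_right hss]
      simp only [mul_assoc]
      rw [← mul_assoc s s, hss, one_mul]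
    rwa [this]) (by
    rw [mul_assoc b, hss, mul_one]
    omega)
  rw [mul_assoc y, mul_assoc b, hss, mul_one, ← mul_assoc] at h
  omega

/-- Deodhar's lemma: for a minimal right coset representative `d` of `W_I` and an ascent `s` of
`d`, either `dsd⁻¹ ∈ I` or `ds` is again a minimal right coset representative. -/
lemma conj_mem_or_inv_mul_mem_minCoset (cs : CoxeterSystem M W) {I : Finset W}
    (hI : I ⊆ Simples cs) {d s : W} (hd : d⁻¹ ∈ minCoset cs Set.univ I) (hs : s ∈ Simples cs)
    (hds : cs.length d < cs.length (d * s)) :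
    d * s * d⁻¹ ∈ I ∨ (d * s)⁻¹ ∈ minCoset cs Set.univ I := by
  by_contra! hn
  obtain ⟨h1, h2⟩ := hn
  rw [mem_minCoset] at h2
  push Not at h2
  obtain ⟨r, hr, hle⟩ := h2
  obtain ⟨i, rfl⟩ := mem_simples.1 hs
  obtain ⟨j, rfl⟩ := mem_simples.1 (hI hr)
  have h3 := mem_minCoset.1 hd _ hr
  have e1 : d⁻¹ * cs.simple j = (cs.simple j * d)⁻¹ := by simp
  have e2 : (d * cs.simple i)⁻¹ * cs.simple j = (cs.simple j * d * cs.simple i)⁻¹ := by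
    simp [mul_assoc]
  rw [e1, cs.length_inv, cs.length_inv] at h3
  rw [e2, cs.length_inv, cs.length_inv] at hle
  have h4 : cs.length (cs.simple j * d) = cs.length d + 1 := by
    rcases cs.length_simple_mul d j with h | h <;> omega
  have h5 : cs.length (d * cs.simple i) = cs.length d + 1 := by
    rcases cs.length_mul_simple d i with h | h <;> omega
  rcases length_mul_simple_lt_or cs (cs.simple j) d i
    (lt_of_le_of_ne (by omega) (cs.length_mul_simple_ne _ i)) with h | h
  · omega
  · rw [cs.length_simple, Nat.lt_one_iff, cs.length_eq_zero_iff] at h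
    apply h1
    rw [← inv_eq_of_mul_eq_one_right h, cs.inv_simple]
    exact hr

/-! ### Solomon's product formula -/

/-- The representatives of the double cosets `W_I \ W / W_K` of minimal length. -/
def doubleCosetReps (cs : CoxeterSystem M W) (I K : Finset W) : Finset W :=
  (minCoset cs Set.univ K).filter fun d => d⁻¹ ∈ minCoset cs Set.univ I

/-- The subset `K ∩ d⁻¹Id` of `K`. -/
def interConj (I K : Finset W) (d : W) : Finset W := K.filter fun s => d * s * d⁻¹ ∈ I

lemma existsUnique_doubleCosetRep (cs : CoxeterSystem M W) {I K : Finset W}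
    (hI : I ⊆ Simples cs) {b : W} (hb : b ∈ minCoset cs Set.univ K) :
    ∃! d, d ∈ doubleCosetReps cs I K ∧ b * d⁻¹ ∈ Subgroup.closure (I : Set W) := by
  obtain ⟨y, hy, a, ha, hya⟩ := exists_mul_of_minCoset cs hI b⁻¹
  have hbd : b = a⁻¹ * y⁻¹ := by rw [← mul_inv_rev, hya, inv_inv]
  refine ⟨y⁻¹, ⟨Finset.mem_filter.2 ⟨mem_minCoset.2 fun s hs => ?_, by simpa using hy⟩, ?_⟩, ?_⟩
  · have h1 := mem_minCoset.1 hb s hs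
    have h2 : cs.length b = cs.length y⁻¹ + cs.length a⁻¹ := by
      rw [← cs.length_inv b, ← hya, length_mul_of_mem_minCoset cs hI hy ha, cs.length_inv,
        cs.length_inv]
    have h3 := cs.length_mul_le a⁻¹ (y⁻¹ * s)
    rw [← mul_assoc, ← hbd] at h3
    omega
  · rw [hbd]
    simpa using ha
  · rintro d ⟨hd, hbd'⟩
    rw [← inv_inj, inv_inv]
    refine eq_of_mem_minCoset cs hI (Finset.mem_filter.1 hd).2 hy ?_
    have e : d⁻¹⁻¹ * y = (b * d⁻¹)⁻¹ * a⁻¹ := by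
      rw [hbd]
      group
    rw [e]
    exact mul_mem (inv_mem hbd') (inv_mem ha)

lemma sum_minCoset_eq_sum_doubleCosetReps {V : Type*} [AddCommMonoid V]
    (cs : CoxeterSystem M W) {I K : Finset W} (hI : I ⊆ Simples cs) (h : W → V) :
    ∑ b ∈ minCoset cs Set.univ K, h b =
      ∑ d ∈ doubleCosetReps cs I K,
        ∑ b ∈ (minCoset cs Set.univ K).filter
          (fun b => b * d⁻¹ ∈ Subgroup.closure (I : Set W)), h b := by
  simp_rw [Finset.sum_filter]
  rw [Finset.sum_comm]
  refine Finset.sum_congr rfl fun b hb => ?_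
  obtain ⟨d, ⟨hd, hbd⟩, huniq⟩ := existsUnique_doubleCosetRep cs hI hb
  rw [Finset.sum_eq_single_of_mem d hd, if_pos hbd]
  intro d' hd' hne
  rw [if_neg fun h' => hne (huniq d' ⟨hd', h'⟩)]

omit [Fintype W] [DecidableEq W] in
lemma conj_mem_closure_iff {I : Finset W} {b d s : W}
    (hbd : b * d⁻¹ ∈ Subgroup.closure (I : Set W)) :
    b * s * b⁻¹ ∈ Subgroup.closure (I : Set W) ↔
      d * s * d⁻¹ ∈ Subgroup.closure (I : Set W) := by
  have e : b * s * b⁻¹ = b * d⁻¹ * (d * s * d⁻¹) * (b * d⁻¹)⁻¹ := by group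
  rw [e, Subgroup.mul_mem_cancel_right _ (inv_mem hbd), Subgroup.mul_mem_cancel_left _ hbd]

lemma conj_mem_iff_mem_closure (cs : CoxeterSystem M W) {I K : Finset W}
    (hI : I ⊆ Simples cs) (hK : K ⊆ Simples cs) {d s : W}
    (hd : d ∈ doubleCosetReps cs I K) (hs : s ∈ K) :
    d * s * d⁻¹ ∈ I ↔ d * s * d⁻¹ ∈ Subgroup.closure (I : Set W) := by
  refine ⟨fun h => Subgroup.subset_closure h, fun h => ?_⟩
  obtain ⟨hdK, hdI⟩ := Finset.mem_filter.1 hd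
  refine mem_of_mem_closure_of_length_eq_one cs hI h ?_
  have h1 := length_mul_of_mem_minCoset cs hI hdI (inv_mem h)
  have e : d⁻¹ * (d * s * d⁻¹)⁻¹ = (d * s)⁻¹ := by group
  have h2 := mem_minCoset.1 hdK s hs
  rw [e, cs.length_inv, cs.length_inv, cs.length_inv] at h1
  obtain ⟨i, rfl⟩ := mem_simples.1 (hK hs)
  rcases cs.length_mul_simple d i with h3 | h3 <;> omega

/-- Multiplication identifies `W^I × (W^K ∩ W_I d)` with `W^{K ∩ d⁻¹Id}`. -/
lemma sum_minCoset_interConj {V : Type*} [AddCommMonoid V] (cs : CoxeterSystem M W)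
    {I K : Finset W} (hI : I ⊆ Simples cs) (hK : K ⊆ Simples cs) {d : W}
    (hd : d ∈ doubleCosetReps cs I K) (g : W → V) :
    ∑ w ∈ minCoset cs Set.univ (interConj I K d), g w =
      ∑ b ∈ (minCoset cs Set.univ K).filter
        (fun b => b * d⁻¹ ∈ Subgroup.closure (I : Set W)),
          ∑ y ∈ minCoset cs Set.univ I, g (y * b) := by
  rw [← Finset.sum_product']
  symm
  obtain ⟨hdK, hdI⟩ := Finset.mem_filter.1 hd
  refine Finset.sum_bij (fun p _ => p.2 * p.1) ?_ ?_ ?_ (fun _ _ => rfl)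
  · rintro ⟨b, y⟩ hp
    obtain ⟨hb, hy⟩ := Finset.mem_product.1 hp
    obtain ⟨hbK, hbd⟩ := Finset.mem_filter.1 hb
    refine mem_minCoset.2 fun s hs => ?_
    obtain ⟨hsK, hsI⟩ := Finset.mem_filter.1 hs
    exact length_lt_mul_mul cs hI hy (hK hsK)
      ((conj_mem_closure_iff hbd).2 (Subgroup.subset_closure hsI)) (mem_minCoset.1 hbK s hsK)
  · rintro ⟨b, y⟩ hp ⟨b', y'⟩ hp' heq
    obtain ⟨hb, hy⟩ := Finset.mem_product.1 hp
    obtain ⟨hb', hy'⟩ := Finset.mem_product.1 hp'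
    have hbd := (Finset.mem_filter.1 hb).2
    have hbd' := (Finset.mem_filter.1 hb').2
    simp only at heq hy hy' hbd hbd'
    have hyy : y = y' := by
      refine eq_of_mem_minCoset cs hI hy hy' ?_
      have e : y⁻¹ * y' = b * d⁻¹ * (b' * d⁻¹)⁻¹ := by
        have : y⁻¹ * y' = b * b'⁻¹ := by
          rw [inv_mul_eq_iff_eq_mul, ← mul_assoc, heq, mul_inv_cancel_right]
        rw [this]
        group
      rw [e]
      exact mul_mem hbd (inv_mem hbd')
    subst hyy
    rw [mul_left_cancel heq]
  · intro w hw
    obtain ⟨y, hy, a, ha, hya⟩ := exists_mul_of_minCoset cs hI (w * d⁻¹)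
    have hbd : a * d * d⁻¹ ∈ Subgroup.closure (I : Set W) := by simpa using ha
    have hw' : y * (a * d) = w := by rw [← mul_assoc, hya, inv_mul_cancel_right]
    refine ⟨(a * d, y), Finset.mem_product.2 ⟨Finset.mem_filter.2
      ⟨mem_minCoset.2 fun s hs => ?_, hbd⟩, hy⟩, hw'⟩
    rcases conj_mem_or_inv_mul_mem_minCoset cs hI hdI (hK hs) (mem_minCoset.1 hdK s hs) with h | h
    · refine length_lt_of_mul_mul cs hI hy (hK hs)
        ((conj_mem_closure_iff hbd).2 (Subgroup.subset_closure h)) ?_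
      rw [hw']
      exact mem_minCoset.1 hw s (Finset.mem_filter.2 ⟨hs, h⟩)
    · have h1 := length_mul_of_mem_minCoset cs hI h (inv_mem ha)
      have h2 := length_mul_of_mem_minCoset cs hI hdI (inv_mem ha)
      rw [← mul_inv_rev, cs.length_inv, cs.length_inv, cs.length_inv] at h1 h2
      have h3 := mem_minCoset.1 hdK s hs
      simp only
      rw [mul_assoc]
      omega

/-- Solomon's product formula. -/
lemma xRel_mul_xRel (cs : CoxeterSystem M W) {I K : Finset W} (hI : I ⊆ Simples cs)
    (hK : K ⊆ Simples cs) :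
    xRel cs Set.univ I * xRel cs Set.univ K =
      ∑ d ∈ doubleCosetReps cs I K, xRel cs Set.univ (interConj I K d) := by
  have h : ∀ d ∈ doubleCosetReps cs I K, xRel cs Set.univ (interConj I K d) =
      ∑ b ∈ (minCoset cs Set.univ K).filter
        (fun b => b * d⁻¹ ∈ Subgroup.closure (I : Set W)),
          ∑ y ∈ minCoset cs Set.univ I, of ℂ W (y * b) :=
    fun d hd => sum_minCoset_interConj cs hI hK hd _
  rw [Finset.sum_congr rfl h, ← sum_minCoset_eq_sum_doubleCosetReps cs hI, xRel, xRel,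
    Finset.sum_mul_sum, Finset.sum_comm]
  simp_rw [map_mul]

/-! ### The structure constants of the quasi-idempotents -/

lemma takes_mul_iff (cs : CoxeterSystem M W) {I K L : Finset W} (hI : I ⊆ Simples cs)
    (hK : K ⊆ Simples cs) (hL : L ⊆ K) {y b : W} (hy : y ∈ minCoset cs Set.univ I)
    (hb : b ∈ minCoset cs Set.univ K) :
    ((∀ s ∈ L, b * s * b⁻¹ ∈ Subgroup.closure (I : Set W)) ∧
        Takes cs (Simples cs) (y * b) L) ↔
      Takes cs (Simples cs) b L ∧ conjF b L ⊆ I ∧ Takes cs (Simples cs) y (conjF b L) := by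
  have hasc : ∀ {w s : W}, s ∈ Simples cs → cs.length w < cs.length (w * s) →
      cs.length (w * s) = cs.length w + 1 := by
    intro w s hs h
    obtain ⟨i, rfl⟩ := mem_simples.1 hs
    rcases cs.length_mul_simple w i with h' | h' <;> omega
  have hconj : ∀ s : W, y * b * s * (y * b)⁻¹ = y * (b * s * b⁻¹) * y⁻¹ := fun s => by group
  constructor
  · rintro ⟨h1, h2⟩
    have hmem : ∀ s ∈ L, b * s * b⁻¹ ∈ I := by
      intro s hs
      refine mem_of_mem_closure_of_length_eq_one cs hI (h1 s hs) ?_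
      have h3 := (h2 s hs).1
      rw [hconj] at h3
      obtain ⟨j, hj⟩ := mem_simples.1 h3
      have h4 := length_mul_of_mem_minCoset cs hI hy (h1 s hs)
      rw [mul_inv_eq_iff_eq_mul.1 hj.symm] at h4
      have h5 := cs.length_mul_le (cs.simple j) y
      rw [cs.length_simple] at h5
      have h6 : cs.length (b * s * b⁻¹) ≠ 0 := by
        rw [Ne, cs.length_eq_zero_iff, conj_eq_one_iff]
        obtain ⟨i, rfl⟩ := mem_simples.1 (hK (hL hs))
        rw [← cs.length_eq_zero_iff, cs.length_simple]
        exact one_ne_zero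
      omega
    refine ⟨fun s hs => ⟨hI (hmem s hs), hasc (hK (hL hs)) (mem_minCoset.1 hb s (hL hs))⟩,
      ?_, ?_⟩
    · intro t ht
      obtain ⟨s, hs, rfl⟩ := Finset.mem_image.1 ht
      exact hmem s hs
    · intro t ht
      obtain ⟨s, hs, rfl⟩ := Finset.mem_image.1 ht
      refine ⟨hconj s ▸ (h2 s hs).1, hasc (hI (hmem s hs)) (mem_minCoset.1 hy _ (hmem s hs))⟩
  · rintro ⟨h1, h2, h3⟩
    have hmem : ∀ s ∈ L, b * s * b⁻¹ ∈ conjF b L := fun s hs =>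
      Finset.mem_image_of_mem _ hs
    have hcl : ∀ s ∈ L, b * s * b⁻¹ ∈ Subgroup.closure (I : Set W) := fun s hs =>
      Subgroup.subset_closure (h2 (hmem s hs))
    refine ⟨hcl, fun s hs => ⟨hconj s ▸ (h3 _ (hmem s hs)).1, ?_⟩⟩
    exact hasc (hK (hL hs)) (length_lt_mul_mul cs hI hy (hK (hL hs)) (hcl s hs)
      (mem_minCoset.1 hb s (hL hs)))

omit [Fintype W] in
lemma conjF_mul (y b : W) (L : Finset W) : conjF (y * b) L = conjF y (conjF b L) := by
  simp only [conjF, Finset.image_image]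
  congr 1
  funext s
  simp [mul_assoc]

/-- The coefficients `m^σ` are compatible with Solomon's product formula. -/
lemma sum_mC_interConj (cs : CoxeterSystem M W) (σ : Finset W → ℝ) {I K L : Finset W}
    (hI : I ⊆ Simples cs) (hK : K ⊆ Simples cs) (hL : L ⊆ K) :
    ∑ d ∈ doubleCosetReps cs I K, mC cs Set.univ (Simples cs) σ L (interConj I K d) =
      ∑ b ∈ (minCoset cs Set.univ K).filter (fun b => Takes cs (Simples cs) b L),
        mC cs Set.univ (Simples cs) σ (conjF b L) I := by
  have h : ∀ d ∈ doubleCosetReps cs I K,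
      mC cs Set.univ (Simples cs) σ L (interConj I K d) =
        ∑ b ∈ (minCoset cs Set.univ K).filter
          (fun b => b * d⁻¹ ∈ Subgroup.closure (I : Set W)),
            ∑ y ∈ minCoset cs Set.univ I,
              if (∀ s ∈ L, b * s * b⁻¹ ∈ Subgroup.closure (I : Set W)) ∧
                  Takes cs (Simples cs) (y * b) L
                then σ (conjF (y * b) L) else 0 := by
    intro d hd
    have hsub : L ⊆ interConj I K d ↔
        ∀ s ∈ L, d * s * d⁻¹ ∈ Subgroup.closure (I : Set W) := by
      constructor
      · intro h s hs
        exact Subgroup.subset_closure (Finset.mem_filter.1 (h hs)).2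
      · intro h s hs
        exact Finset.mem_filter.2
          ⟨hL hs, (conj_mem_iff_mem_closure cs hI hK hd (hL hs)).2 (h s hs)⟩
    have hb : ∀ b ∈ (minCoset cs Set.univ K).filter
          (fun b => b * d⁻¹ ∈ Subgroup.closure (I : Set W)),
        ((∀ s ∈ L, b * s * b⁻¹ ∈ Subgroup.closure (I : Set W)) ↔ L ⊆ interConj I K d) := by
      intro b hb
      rw [hsub]
      exact forall₂_congr fun s _ => conj_mem_closure_iff (Finset.mem_filter.1 hb).2
    rw [mC, Finset.sum_filter, sum_minCoset_interConj cs hI hK hd]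
    split_ifs with hLd
    · refine Finset.sum_congr rfl fun b hb' => Finset.sum_congr rfl fun y _ => ?_
      exact if_congr (and_iff_right ((hb b hb').2 hLd)).symm rfl rfl
    · symm
      refine Finset.sum_eq_zero fun b hb' => Finset.sum_eq_zero fun y _ => ?_
      rw [if_neg fun h => hLd ((hb b hb').1 h.1)]
  rw [Finset.sum_congr rfl h, ← sum_minCoset_eq_sum_doubleCosetReps cs hI, Finset.sum_filter]
  refine Finset.sum_congr rfl fun b hb => ?_
  rw [mC, Finset.sum_filter, ← ite_and]
  split_ifs with hc
  · refine Finset.sum_congr rfl fun y hy => ?_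
    rw [conjF_mul]
    refine if_congr ((takes_mul_iff cs hI hK hL hy hb).trans
      ⟨fun h => h.2.2, fun h => ⟨hc.1, hc.2, h⟩⟩) rfl rfl
  · refine Finset.sum_eq_zero fun y hy => if_neg fun h => hc ?_
    have := (takes_mul_iff cs hI hK hL hy hb).1 h
    exact ⟨this.1, this.2.1⟩

omit [DecidableEq W] in
lemma takes_one (cs : CoxeterSystem M W) {K : Finset W} (hK : K ⊆ Simples cs) :
    Takes cs (Simples cs) 1 K := by
  intro s hs
  refine ⟨by simpa using hK hs, ?_⟩
  obtain ⟨i, rfl⟩ := mem_simples.1 (hK hs)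
  rw [one_mul, cs.length_one, cs.length_simple]

omit [Fintype W] in
lemma conjF_one (K : Finset W) : conjF 1 K = K := by
  simp [conjF]

lemma conjF_subset_of_takes {cs : CoxeterSystem M W} {w : W} {L : Finset W}
    (h : Takes cs (Simples cs) w L) : conjF w L ⊆ Simples cs := by
  intro t ht
  obtain ⟨s, hs, rfl⟩ := Finset.mem_image.1 ht
  exact (h s hs).1

lemma one_mem_minCoset (cs : CoxeterSystem M W) {K : Finset W} (hK : K ⊆ Simples cs) :
    (1 : W) ∈ minCoset cs Set.univ K := by
  refine mem_minCoset.2 fun s hs => ?_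
  rw [(takes_one cs hK s hs).2]
  omega

lemma minCoset_simples (cs : CoxeterSystem M W) :
    minCoset cs Set.univ (Simples cs) = {1} := by
  refine Finset.eq_singleton_iff_unique_mem.2
    ⟨one_mem_minCoset cs subset_rfl, fun w hw => ?_⟩
  by_contra hne
  obtain ⟨i, hi⟩ := cs.exists_rightDescent_of_ne_one hne
  have := mem_minCoset.1 hw _ (mem_simples.2 ⟨i, rfl⟩)
  exact absurd hi (not_lt.2 this.le)

lemma mC_self_pos (cs : CoxeterSystem M W) {σ : Finset W → ℝ} (hσ : PosOn (Simples cs) σ)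
    {K : Finset W} (hK : K ⊆ Simples cs) : 0 < mC cs Set.univ (Simples cs) σ K K := by
  rw [mC, if_pos subset_rfl]
  refine Finset.sum_pos (fun w hw => hσ _ (Finset.mem_powerset.2
    (conjF_subset_of_takes (Finset.mem_filter.1 hw).2))) ⟨1, ?_⟩
  exact Finset.mem_filter.2 ⟨one_mem_minCoset cs hK, takes_one cs hK⟩

lemma mC_simples (cs : CoxeterSystem M W) (σ : Finset W → ℝ) {J : Finset W}
    (hJ : J ⊆ Simples cs) : mC cs Set.univ (Simples cs) σ J (Simples cs) = σ J := by
  rw [mC, if_pos hJ, minCoset_simples, Finset.sum_filter, Finset.sum_singleton,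
    if_pos (takes_one cs hJ), conjF_one]

/-- The triangular system defining the quasi-idempotents has only the trivial solution when its
left-hand sides vanish. -/
lemma eq_zero_of_sum_mC_smul (cs : CoxeterSystem M W) {σ : Finset W → ℝ}
    (hσ : PosOn (Simples cs) σ) {V : Type*} [AddCommGroup V] [Module ℂ V] (F : Finset W → V)
    (h : ∀ K ⊆ Simples cs,
      ∑ J ∈ K.powerset, (mC cs Set.univ (Simples cs) σ J K : ℂ) • F J = 0)
    {K : Finset W} (hK : K ⊆ Simples cs) : F K = 0 := by
  induction K using Finset.strongInduction with
  | H K ih =>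
    have h1 := h K hK
    rw [Finset.sum_eq_single_of_mem K (Finset.mem_powerset_self K)] at h1
    · refine (smul_eq_zero.1 h1).resolve_left ?_
      exact_mod_cast (mC_self_pos cs hσ hK).ne'
    · intro J hJ hne
      have hJK := Finset.mem_powerset.1 hJ
      rw [ih J (Finset.ssubset_iff_subset_ne.2 ⟨hJK, hne⟩) (hJK.trans hK), smul_zero]

/-- The number of `w ∈ W^K` that map `Δ_L` onto `Δ_J`. -/
def transporterCard (cs : CoxeterSystem M W) (J L K : Finset W) : ℕ :=
  #{w ∈ (minCoset cs Set.univ K).filter (fun w => Takes cs (Simples cs) w L) | conjF w L = J}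

/-- The quasi-idempotents span right ideals of the descent algebra, with structure constants
that do not depend on `σ`. -/
lemma bbht_mul_xRel (cs : CoxeterSystem M W) {σ : Finset W → ℝ} (hσ : PosOn (Simples cs) σ)
    {e : Finset W → MonoidAlgebra ℂ W} (he : IsBBHT cs Set.univ (Simples cs) σ e)
    {J K : Finset W} (hJ : J ⊆ Simples cs) (hK : K ⊆ Simples cs) :
    e J * xRel cs Set.univ K =
      ∑ L ∈ K.powerset, (transporterCard cs J L K : ℂ) • e L := by
  rw [← sub_eq_zero]
  refine eq_zero_of_sum_mC_smul cs hσ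
    (fun J => e J * xRel cs Set.univ K -
      ∑ L ∈ K.powerset, (transporterCard cs J L K : ℂ) • e L) ?_ hJ
  intro I hI
  simp only [smul_sub, Finset.sum_sub_distrib]
  rw [sub_eq_zero]
  have hleft : ∑ J ∈ I.powerset, (mC cs Set.univ (Simples cs) σ J I : ℂ) •
      (e J * xRel cs Set.univ K) = xRel cs Set.univ I * xRel cs Set.univ K := by
    rw [he I (Finset.mem_powerset.2 hI), Finset.sum_mul]
    simp_rw [smul_mul_assoc]
  have hd : ∀ d ∈ doubleCosetReps cs I K, xRel cs Set.univ (interConj I K d) =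
      ∑ L ∈ K.powerset,
        (mC cs Set.univ (Simples cs) σ L (interConj I K d) : ℂ) • e L := by
    intro d _
    have hsub : interConj I K d ⊆ K := Finset.filter_subset _ _
    rw [he _ (Finset.mem_powerset.2 (hsub.trans hK))]
    refine Finset.sum_subset (Finset.powerset_mono.2 hsub) fun L _ hL => ?_
    rw [mC, if_neg (fun h => hL (Finset.mem_powerset.2 h)), Complex.ofReal_zero, zero_smul]
  rw [hleft, xRel_mul_xRel cs hI hK, Finset.sum_congr rfl hd, Finset.sum_comm]
  simp_rw [Finset.smul_sum]
  rw [Finset.sum_comm (s := I.powerset)]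
  refine Finset.sum_congr rfl fun L hL => ?_
  rw [← Finset.sum_smul, ← Complex.ofReal_sum,
    sum_mC_interConj cs σ hI hK (Finset.mem_powerset.1 hL)]
  simp_rw [smul_smul]
  rw [← Finset.sum_smul]
  congr 1
  have hzero : ∀ b ∈ (minCoset cs Set.univ K).filter (fun b => Takes cs (Simples cs) b L),
      conjF b L ∉ I.powerset → mC cs Set.univ (Simples cs) σ (conjF b L) I = 0 :=
    fun b _ h => if_neg fun h' => h (Finset.mem_powerset.2 h')
  rw [← Finset.sum_filter_of_ne (p := fun b => conjF b L ∈ I.powerset)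
      (fun b hb hne => by_contra fun h => hne (hzero b hb h)),
    ← Finset.sum_fiberwise_of_maps_to (t := I.powerset) (g := fun b => conjF b L)
      (fun b hb => (Finset.mem_filter.1 hb).2), Complex.ofReal_sum]
  refine Finset.sum_congr rfl fun J hJ => ?_
  rw [Finset.filter_filter, Finset.sum_congr rfl (g := fun _ =>
    mC cs Set.univ (Simples cs) σ J I) (fun b hb => by rw [(Finset.mem_filter.1 hb).2.2])]
  rw [Finset.sum_const, nsmul_eq_mul, transporterCard, mul_comm]
  push_cast
  congr 3
  refine Finset.filter_congr fun b _ => ?_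
  constructor
  · exact fun h => h.2
  · rintro rfl
    exact ⟨hJ, rfl⟩

lemma sum_smul_bbht_mul_xRel (cs : CoxeterSystem M W) {σ : Finset W → ℝ}
    (hσ : PosOn (Simples cs) σ) {e : Finset W → MonoidAlgebra ℂ W}
    (he : IsBBHT cs Set.univ (Simples cs) σ e) (τ : Finset W → ℝ) {K : Finset W}
    (hK : K ⊆ Simples cs) :
    (∑ J ∈ (Simples cs).powerset, (τ J : ℂ) • e J) * xRel cs Set.univ K =
      ∑ L ∈ K.powerset, (mC cs Set.univ (Simples cs) τ L K : ℂ) • e L := by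
  rw [Finset.sum_mul]
  have h : ∀ J ∈ (Simples cs).powerset, ((τ J : ℂ) • e J) * xRel cs Set.univ K =
      ∑ L ∈ K.powerset, ((τ J : ℂ) * (transporterCard cs J L K : ℂ)) • e L := by
    intro J hJ
    rw [smul_mul_assoc, bbht_mul_xRel cs hσ he (Finset.mem_powerset.1 hJ) hK, Finset.smul_sum]
    simp_rw [smul_smul]
  rw [Finset.sum_congr rfl h, Finset.sum_comm]
  refine Finset.sum_congr rfl fun L hL => ?_
  rw [← Finset.sum_smul]
  congr 1
  rw [mC, if_pos (Finset.mem_powerset.1 hL),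
    ← Finset.sum_fiberwise_of_maps_to (t := (Simples cs).powerset) (g := fun b => conjF b L)
      (fun b hb => Finset.mem_powerset.2 (conjF_subset_of_takes (Finset.mem_filter.1 hb).2)),
    Complex.ofReal_sum]
  refine Finset.sum_congr rfl fun J _ => ?_
  rw [Finset.sum_congr rfl (g := fun _ => τ J)
    (fun b hb => by rw [(Finset.mem_filter.1 hb).2]), Finset.sum_const, nsmul_eq_mul,
    transporterCard, mul_comm]
  push_cast
  rfl

/-! ### Conjugating the idempotents -/

lemma bbht_mem_descAlg (cs : CoxeterSystem M W) {σ : Finset W → ℝ}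
    (hσ : PosOn (Simples cs) σ) {e : Finset W → MonoidAlgebra ℂ W}
    (he : IsBBHT cs Set.univ (Simples cs) σ e) {J : Finset W} (hJ : J ⊆ Simples cs) :
    e J ∈ descAlg cs := by
  rw [← Submodule.Quotient.mk_eq_zero]
  refine eq_zero_of_sum_mC_smul cs hσ (fun J => (descAlg cs).mkQ (e J)) ?_ hJ
  intro K hK
  have hmem : xRel cs Set.univ K ∈ descAlg cs :=
    Submodule.subset_span ⟨K, Finset.mem_powerset.2 hK, rfl⟩
  rw [he K (Finset.mem_powerset.2 hK)] at hmem
  simp_rw [← map_smul]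
  rw [← map_sum]
  exact (Submodule.Quotient.mk_eq_zero _).2 hmem

lemma sum_smul_bbht_mem_descAlg (cs : CoxeterSystem M W) {σ : Finset W → ℝ}
    (hσ : PosOn (Simples cs) σ) {e : Finset W → MonoidAlgebra ℂ W}
    (he : IsBBHT cs Set.univ (Simples cs) σ e) (τ : Finset W → ℝ) :
    ∑ J ∈ (Simples cs).powerset, (τ J : ℂ) • e J ∈ descAlg cs :=
  Submodule.sum_mem _ fun _ hJ =>
    Submodule.smul_mem _ _ (bbht_mem_descAlg cs hσ he (Finset.mem_powerset.1 hJ))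

lemma sum_smul_bbht_eq_one (cs : CoxeterSystem M W) {σ : Finset W → ℝ}
    {e : Finset W → MonoidAlgebra ℂ W} (he : IsBBHT cs Set.univ (Simples cs) σ e) :
    ∑ J ∈ (Simples cs).powerset, (σ J : ℂ) • e J = 1 := by
  have h := he (Simples cs) (Finset.mem_powerset_self _)
  rw [xRel, minCoset_simples, Finset.sum_singleton, map_one] at h
  rw [h]
  exact Finset.sum_congr rfl fun J hJ => by rw [mC_simples cs σ (Finset.mem_powerset.1 hJ)]

/-- Left multiplication by `∑ σ(J) e'_J` carries the quasi-idempotents for `σ` to the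
quasi-idempotents `e'_J` for another function. -/
lemma sum_smul_bbht_mul_bbht (cs : CoxeterSystem M W) {σ σ' : Finset W → ℝ}
    (hσ : PosOn (Simples cs) σ) (hσ' : PosOn (Simples cs) σ')
    {e e' : Finset W → MonoidAlgebra ℂ W} (he : IsBBHT cs Set.univ (Simples cs) σ e)
    (he' : IsBBHT cs Set.univ (Simples cs) σ' e') {L : Finset W} (hL : L ⊆ Simples cs) :
    (∑ J ∈ (Simples cs).powerset, (σ J : ℂ) • e' J) * e L = e' L := by
  rw [← sub_eq_zero]
  refine eq_zero_of_sum_mC_smul cs hσ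
    (fun L => (∑ J ∈ (Simples cs).powerset, (σ J : ℂ) • e' J) * e L - e' L) ?_ hL
  intro K hK
  simp only [smul_sub, Finset.sum_sub_distrib]
  rw [← sum_smul_bbht_mul_xRel cs hσ' he' σ hK, he K (Finset.mem_powerset.2 hK),
    Finset.mul_sum]
  simp_rw [mul_smul_comm]
  rw [sub_self]

omit [Fintype W] in
lemma shapeEq_conjF_iff {I L : Finset W} (w : W) : ShapeEq I (conjF w L) ↔ ShapeEq I L := by
  have h : Subgroup.closure (conjF w L : Set W) =
      Subgroup.map (MulAut.conj w).toMonoidHom (Subgroup.closure (L : Set W)) := by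
    rw [MonoidHom.map_closure]
    congr 1
    ext t
    simp [conjF]
  constructor
  · rintro ⟨v, hv⟩
    refine ⟨w⁻¹ * v, ?_⟩
    have h2 : Subgroup.closure (L : Set W) = Subgroup.map (MulAut.conj w⁻¹).toMonoidHom
        (Subgroup.closure (conjF w L : Set W)) := by
      rw [h, Subgroup.map_map]
      ext t
      simp [mul_assoc]
    rw [h2, hv, Subgroup.map_map]
    congr 1
    ext t
    simp [mul_assoc]
  · rintro ⟨v, hv⟩
    refine ⟨w * v, ?_⟩
    rw [h, hv, Subgroup.map_map]
    congr 1
    ext t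
    simp [mul_assoc]

/-- Left multiplication by `e_λ` is the projection onto the span of the `e_J` of shape `λ`. -/
lemma shapeIdempotent_mul_bbht (cs : CoxeterSystem M W) {σ : Finset W → ℝ}
    (hσ : PosOn (Simples cs) σ) {e : Finset W → MonoidAlgebra ℂ W}
    (he : IsBBHT cs Set.univ (Simples cs) σ e) (I : Finset W) {L : Finset W}
    (hL : L ⊆ Simples cs) :
    (∑ J ∈ (Simples cs).powerset.filter (fun J => ShapeEq I J), (σ J : ℂ) • e J) * e L =
      if ShapeEq I L then e L else 0 := by
  have hτ : ∑ J ∈ (Simples cs).powerset.filter (fun J => ShapeEq I J), (σ J : ℂ) • e J =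
      ∑ J ∈ (Simples cs).powerset, ((if ShapeEq I J then σ J else 0 : ℝ) : ℂ) • e J := by
    rw [Finset.sum_filter]
    refine Finset.sum_congr rfl fun J _ => ?_
    split_ifs <;> simp
  rw [hτ, ← sub_eq_zero]
  refine eq_zero_of_sum_mC_smul cs hσ
    (fun L => (∑ J ∈ (Simples cs).powerset,
      ((if ShapeEq I J then σ J else 0 : ℝ) : ℂ) • e J) * e L -
        if ShapeEq I L then e L else 0) ?_ hL
  intro K hK
  have h1 := sum_smul_bbht_mul_xRel cs hσ he (fun J => if ShapeEq I J then σ J else 0) hK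
  rw [he K (Finset.mem_powerset.2 hK), Finset.mul_sum] at h1
  simp_rw [mul_smul_comm] at h1
  simp only [smul_sub, Finset.sum_sub_distrib]
  rw [h1, sub_eq_zero]
  refine Finset.sum_congr rfl fun L _ => ?_
  simp only [mC, shapeEq_conjF_iff]
  by_cases hs : ShapeEq I L <;> simp [hs]

/-- Proposition 4.2: for two positive functions `σ`, `σ₁` on `2^S` and a shape `λ`
of `W` (given by a representative `I`), there is a unit `u` of Solomon's descent
algebra with `u e^σ_λ = e^{σ₁}_λ u`; consequently left multiplication by `u` maps
the right ideal `E^σ_λ = e^σ_λ ℂW` isomorphically (as right `ℂW`-modules) onto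
`E^{σ₁}_λ = e^{σ₁}_λ ℂW`. -/
theorem stmt7 (cs : CoxeterSystem M W)
    (σ σ₁ : Finset W → ℝ) (hσ : PosOn (Simples cs) σ) (hσ₁ : PosOn (Simples cs) σ₁)
    (e : Finset W → MonoidAlgebra ℂ W) (he : IsBBHT cs Set.univ (Simples cs) σ e)
    (e₁ : Finset W → MonoidAlgebra ℂ W) (he₁ : IsBBHT cs Set.univ (Simples cs) σ₁ e₁)
    (I : Finset W) (hI : I ⊆ Simples cs) :
    ∃ u u' : MonoidAlgebra ℂ W, u ∈ descAlg cs ∧ u' ∈ descAlg cs ∧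
      u * u' = 1 ∧ u' * u = 1 ∧
      u * (∑ J ∈ (Simples cs).powerset.filter (fun J => ShapeEq I J), (σ J : ℂ) • e J)
        = (∑ J ∈ (Simples cs).powerset.filter (fun J => ShapeEq I J), (σ₁ J : ℂ) • e₁ J) * u ∧
      (fun x => u * x) ''
          (Set.range fun y : MonoidAlgebra ℂ W =>
            (∑ J ∈ (Simples cs).powerset.filter (fun J => ShapeEq I J), (σ J : ℂ) • e J) * y)
        = Set.range fun y : MonoidAlgebra ℂ W =>
            (∑ J ∈ (Simples cs).powerset.filter (fun J => ShapeEq I J), (σ₁ J : ℂ) • e₁ J) * y := by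
  set u : MonoidAlgebra ℂ W := ∑ J ∈ (Simples cs).powerset, (σ J : ℂ) • e₁ J with hu
  set u' : MonoidAlgebra ℂ W := ∑ J ∈ (Simples cs).powerset, (σ₁ J : ℂ) • e J with hu'
  have hmul : ∀ J ⊆ Simples cs, u * e J = e₁ J := fun J hJ =>
    sum_smul_bbht_mul_bbht cs hσ hσ₁ he he₁ hJ
  have hmul' : ∀ J ⊆ Simples cs, u' * e₁ J = e J := fun J hJ =>
    sum_smul_bbht_mul_bbht cs hσ₁ hσ he₁ he hJ
  have huu' : u * u' = 1 := by
    rw [hu', Finset.mul_sum, ← sum_smul_bbht_eq_one cs he₁]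
    refine Finset.sum_congr rfl fun J hJ => ?_
    rw [mul_smul_comm, hmul J (Finset.mem_powerset.1 hJ)]
  have hu'u : u' * u = 1 := by
    rw [hu, Finset.mul_sum, ← sum_smul_bbht_eq_one cs he]
    refine Finset.sum_congr rfl fun J hJ => ?_
    rw [mul_smul_comm, hmul' J (Finset.mem_powerset.1 hJ)]
  have hcomm : u * (∑ J ∈ (Simples cs).powerset.filter (fun J => ShapeEq I J), (σ J : ℂ) • e J) =
      (∑ J ∈ (Simples cs).powerset.filter (fun J => ShapeEq I J), (σ₁ J : ℂ) • e₁ J) * u := by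
    have hright : (∑ J ∈ (Simples cs).powerset.filter (fun J => ShapeEq I J),
        (σ₁ J : ℂ) • e₁ J) * u =
          ∑ J ∈ (Simples cs).powerset.filter (fun J => ShapeEq I J), (σ J : ℂ) • e₁ J := by
      rw [hu, Finset.mul_sum, Finset.sum_filter (s := (Simples cs).powerset)
        (f := fun J => (σ J : ℂ) • e₁ J)]
      refine Finset.sum_congr rfl fun J hJ => ?_
      rw [mul_smul_comm, shapeIdempotent_mul_bbht cs hσ₁ he₁ I (Finset.mem_powerset.1 hJ),
        smul_ite, smul_zero]
    rw [hright, Finset.mul_sum]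
    refine Finset.sum_congr rfl fun J hJ => ?_
    rw [mul_smul_comm, hmul J (Finset.mem_powerset.1 (Finset.mem_filter.1 hJ).1)]
  refine ⟨u, u', sum_smul_bbht_mem_descAlg cs hσ₁ he₁ σ, sum_smul_bbht_mem_descAlg cs hσ he σ₁,
    huu', hu'u, hcomm, ?_⟩
  ext x
  constructor
  · rintro ⟨_, ⟨y, rfl⟩, rfl⟩
    refine ⟨u * y, ?_⟩
    simp only
    rw [← mul_assoc, ← mul_assoc, hcomm]
  · rintro ⟨y, rfl⟩
    refine ⟨_, ⟨u' * y, rfl⟩, ?_⟩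
    simp only
    rw [← mul_assoc, hcomm, mul_assoc, ← mul_assoc u, huu', one_mul]

end DPR
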